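/- The space of sl_2-invariant 2-cocycles of the Heisenberg ideal h_2 with values in the adjoint module sch_2 has dimension 4; concretely, it consists exactly of the alternating bilinear maps φ determined by parameters α, β, γ, μ via φ(x_1,x_2)=-2γe, φ(x_1,y_1)=αz, φ(x_1,y_2)=γh+μz, φ(y_1,y_2)=2γf, φ(x_2,y_2)=βz, φ(x_2,y_1)=-γh+μz, φ(x_1,z)=-3γx_2, φ(y_1,z)=-3γy_2, φ(x_2,z)=3γx_1, φ(y_2,z)=3γy_1. -/

import Mathlib

open scoped BigOperators

/-- Basis index set for the `n`-th Schrödinger algebra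
`sch_n = span {h, e, f, x_1, …, x_n, y_1, …, y_n, z}`. -/
inductive SchIdx (n : ℕ) : Type
  | H : SchIdx n
  | E : SchIdx n
  | F : SchIdx n
  | X : Fin n → SchIdx n
  | Y : Fin n → SchIdx n
  | Z : SchIdx n
  deriving DecidableEq

/-- The underlying vector space of the `n`-th Schrödinger algebra. -/
abbrev Sch (n : ℕ) : Type := SchIdx n → ℂ

/-- The Lie bracket of `sch_n`, written componentwise with respect to the basis;
it encodes exactly the relations `[e,f]=h, [h,e]=2e, [h,f]=-2f, [x_i,y_i]=z,
[h,x_i]=x_i, [h,y_i]=-y_i, [e,y_i]=x_i, [f,x_i]=y_i`. -/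
noncomputable def br {n : ℕ} (u v : Sch n) : Sch n := fun j =>
  match j with
  | .H => u .E * v .F - u .F * v .E
  | .E => 2 * (u .H * v .E - u .E * v .H)
  | .F => -2 * (u .H * v .F - u .F * v .H)
  | .X i => (u .H * v (.X i) - u (.X i) * v .H) + (u .E * v (.Y i) - u (.Y i) * v .E)
  | .Y i => -(u .H * v (.Y i) - u (.Y i) * v .H) + (u .F * v (.X i) - u (.X i) * v .F)
  | .Z => ∑ i : Fin n, (u (.X i) * v (.Y i) - u (.Y i) * v (.X i))

/-- The bracket of `sch_n` as a bilinear map. -/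
noncomputable def brL (n : ℕ) : Sch n →ₗ[ℂ] Sch n →ₗ[ℂ] Sch n :=
  LinearMap.mk₂ ℂ br
    (by
      intro m m' v; funext j; cases j <;> simp only [br, Pi.add_apply]
      case Z => rw [← Finset.sum_add_distrib]; exact Finset.sum_congr rfl fun i _ => by ring
      all_goals ring)
    (by
      intro c m v; funext j; cases j <;> simp only [br, Pi.smul_apply, smul_eq_mul]
      case Z => rw [Finset.mul_sum]; exact Finset.sum_congr rfl fun i _ => by ring
      all_goals ring)
    (by
      intro m v v'; funext j; cases j <;> simp only [br, Pi.add_apply]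
      case Z => rw [← Finset.sum_add_distrib]; exact Finset.sum_congr rfl fun i _ => by ring
      all_goals ring)
    (by
      intro c m v; funext j; cases j <;> simp only [br, Pi.smul_apply, smul_eq_mul]
      case Z => rw [Finset.mul_sum]; exact Finset.sum_congr rfl fun i _ => by ring
      all_goals ring)

/-- The basis vector `h`. -/
noncomputable def hV (n : ℕ) : Sch n := Pi.single SchIdx.H 1
/-- The basis vector `e`. -/
noncomputable def eV (n : ℕ) : Sch n := Pi.single SchIdx.E 1
/-- The basis vector `f`. -/
noncomputable def fV (n : ℕ) : Sch n := Pi.single SchIdx.F 1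
/-- The central basis vector `z`. -/
noncomputable def zV (n : ℕ) : Sch n := Pi.single SchIdx.Z 1
/-- The basis vector `x_i`. -/
noncomputable def xV {n : ℕ} (i : Fin n) : Sch n := Pi.single (SchIdx.X i) 1
/-- The basis vector `y_i`. -/
noncomputable def yV {n : ℕ} (i : Fin n) : Sch n := Pi.single (SchIdx.Y i) 1

/-- The subalgebra `sl_2 = span {e, f, h}` of `sch_n`. -/
noncomputable def sl2 (n : ℕ) : Submodule ℂ (Sch n) :=
  Submodule.span ℂ {eV n, fV n, hV n}
/-- Basis index set for the Heisenberg ideal `h_n = span {x_1, …, x_n, y_1, …, y_n, z}`. -/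
inductive HIdx (n : ℕ) : Type
  | X : Fin n → HIdx n
  | Y : Fin n → HIdx n
  | Z : HIdx n
  deriving DecidableEq

/-- The underlying vector space of the Heisenberg ideal `h_n` of `sch_n`. -/
abbrev Heis (n : ℕ) : Type := HIdx n → ℂ

/-- The natural inclusion `h_n → sch_n`. -/
noncomputable def ιH {n : ℕ} (a : Heis n) : Sch n := fun j =>
  match j with
  | .X i => a (.X i)
  | .Y i => a (.Y i)
  | .Z => a .Z
  | .H => 0
  | .E => 0
  | .F => 0

/-- The action of `v ∈ sch_n` on the ideal `h_n`: `act v a = [v, a]`, viewed inside `h_n`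
(the ideal `h_n` is stable under taking brackets with any element). -/
noncomputable def act {n : ℕ} (v : Sch n) (a : Heis n) : Heis n := fun j =>
  match j with
  | .X i => brL n v (ιH a) (SchIdx.X i)
  | .Y i => brL n v (ιH a) (SchIdx.Y i)
  | .Z => brL n v (ιH a) SchIdx.Z

/-- The bracket of the Heisenberg algebra `h_n`. -/
noncomputable def brH {n : ℕ} (a b : Heis n) : Heis n := act (ιH a) b

/-- The basis vector `x_i` of `h_n`. -/
noncomputable def xH {n : ℕ} (i : Fin n) : Heis n := Pi.single (HIdx.X i) 1
/-- The basis vector `y_i` of `h_n`. -/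
noncomputable def yH {n : ℕ} (i : Fin n) : Heis n := Pi.single (HIdx.Y i) 1
/-- The basis vector `z` of `h_n`. -/
noncomputable def zH (n : ℕ) : Heis n := Pi.single HIdx.Z 1
noncomputable instance (n : ℕ) : AddCommGroup (Heis n →ₗ[ℂ] Heis n →ₗ[ℂ] Sch n) :=
  LinearMap.addCommGroup

noncomputable instance (n : ℕ) : Module ℂ (Heis n →ₗ[ℂ] Heis n →ₗ[ℂ] Sch n) :=
  LinearMap.module
/-- The space of `sl_2`-invariant 2-cocycles of the Heisenberg ideal `h_n` with values in
the adjoint module `sch_n`: alternating bilinear maps `φ : h_n × h_n → sch_n` with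
`[a,φ(b,c)] + [b,φ(c,a)] + [c,φ(a,b)] + φ(a,[b,c]) + φ(b,[c,a]) + φ(c,[a,b]) = 0` and
`[v,φ(a,b)] - φ([v,a],b) - φ(a,[v,b]) = 0` for all `v ∈ sl_2`. -/
noncomputable def adjInvZ2Heis (n : ℕ) : Submodule ℂ (Heis n →ₗ[ℂ] Heis n →ₗ[ℂ] Sch n) where
  carrier := {φ | (∀ a, φ a a = 0) ∧
    (∀ a b c, brL n (ιH a) (φ b c) + brL n (ιH b) (φ c a) + brL n (ιH c) (φ a b) +
      φ a (brH b c) + φ b (brH c a) + φ c (brH a b) = 0) ∧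
    ∀ v ∈ sl2 n, ∀ a b, brL n v (φ a b) - φ (act v a) b - φ a (act v b) = 0}
  add_mem' := by
    rintro φ ψ ⟨hφ1, hφ2, hφ3⟩ ⟨hψ1, hψ2, hψ3⟩
    refine ⟨fun a => ?_, fun a b c => ?_, fun v hv a b => ?_⟩
    · simp only [LinearMap.add_apply, hφ1 a, hψ1 a, add_zero]
    · simp only [LinearMap.add_apply, map_add]
      linear_combination hφ2 a b c + hψ2 a b c
    · simp only [LinearMap.add_apply, map_add]
      linear_combination hφ3 v hv a b + hψ3 v hv a b
  zero_mem' := ⟨fun a => rfl, fun a b c => by simp, fun v hv a b => by simp⟩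
  smul_mem' := by
    rintro c φ ⟨hφ1, hφ2, hφ3⟩
    refine ⟨fun a => ?_, fun a b c' => ?_, fun v hv a b => ?_⟩
    · simp only [LinearMap.smul_apply, hφ1 a, smul_zero]
    · simp only [LinearMap.smul_apply, map_smul]
      simp only [← smul_add]
      rw [hφ2 a b c', smul_zero]
    · simp only [LinearMap.smul_apply, map_smul]
      simp only [← smul_sub]
      rw [hφ3 v hv a b, smul_zero]
section Bracket

variable {n : ℕ}

theorem act_hV_xH (i : Fin n) : act (hV n) (xH i) = xH i := by
  funext j; cases j <;> simp [act, brL, br, ιH, hV, xH, Pi.single_apply]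

theorem act_hV_yH (i : Fin n) : act (hV n) (yH i) = -yH i := by
  funext j; cases j <;> simp [act, brL, br, ιH, hV, yH, Pi.single_apply]

theorem act_eV_xH (i : Fin n) : act (eV n) (xH i) = 0 := by
  funext j; cases j <;> simp [act, brL, br, ιH, eV, xH, Pi.single_apply]

theorem act_eV_yH (i : Fin n) : act (eV n) (yH i) = xH i := by
  funext j; cases j <;> simp [act, brL, br, ιH, eV, xH, yH, Pi.single_apply]

theorem act_fV_xH (i : Fin n) : act (fV n) (xH i) = yH i := by
  funext j; cases j <;> simp [act, brL, br, ιH, fV, xH, yH, Pi.single_apply]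

theorem act_fV_zH : act (fV n) (zH n) = 0 := by
  funext j; cases j <;> simp [act, brL, br, ιH, fV, zH]

theorem brH_xH_xH (i j : Fin n) : brH (xH i) (xH j) = 0 := by
  funext k; cases k <;> simp [brH, act, brL, br, ιH, xH, Pi.single_apply]

theorem brH_xH_yH (i j : Fin n) : brH (xH i) (yH j) = if i = j then zH n else 0 := by
  rcases eq_or_ne i j with rfl | hij <;> funext k <;> cases k <;>
    simp_all [brH, act, brL, br, ιH, xH, yH, zH, Pi.single_apply, Ne.symm]

theorem brH_yH_xH (i j : Fin n) : brH (yH i) (xH j) = if i = j then -zH n else 0 := by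
  rcases eq_or_ne i j with rfl | hij <;> funext k <;> cases k <;>
    simp_all [brH, act, brL, br, ιH, xH, yH, zH, Pi.single_apply, Ne.symm]

theorem brL_eV_hV : brL n (eV n) (hV n) = (-2 : ℂ) • eV n := by
  funext k; cases k <;> simp [brL, br, eV, hV]

theorem brL_eV_fV : brL n (eV n) (fV n) = hV n := by
  funext k; cases k <;> simp [brL, br, eV, fV, hV]

theorem brL_fV_xV (i : Fin n) : brL n (fV n) (xV i) = yV i := by
  funext k; cases k <;> simp [brL, br, fV, xV, yV, Pi.single_apply]

theorem brL_xH_hV (i : Fin n) : brL n (ιH (xH i)) (hV n) = -xV i := by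
  funext k; cases k <;> simp [brL, br, ιH, xH, hV, xV, Pi.single_apply]

theorem brL_yH_eV (i : Fin n) : brL n (ιH (yH i)) (eV n) = -xV i := by
  funext k; cases k <;> simp [brL, br, ιH, yH, eV, xV, Pi.single_apply]

theorem brL_zV (v : Sch n) : brL n v (zV n) = 0 := by
  funext k; cases k <;> simp [brL, br, zV]

theorem apply_eq_zero_of_mem_sl2 {v : Sch n} (hv : v ∈ sl2 n) :
    (∀ i, v (.X i) = 0) ∧ (∀ i, v (.Y i) = 0) ∧ v .Z = 0 := by
  induction hv using Submodule.span_induction with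
  | mem v hv =>
    rcases hv with rfl | rfl | rfl <;> simp [eV, fV, hV]
  | zero => simp
  | add u v _ _ hu hv => simp_all
  | smul c v _ hv => simp_all

theorem heis_decomposition (a : Heis n) :
    a = ∑ i, a (.X i) • xH i + ∑ i, a (.Y i) • yH i + a .Z • zH n := by
  funext j
  cases j <;> simp [xH, yH, zH, Finset.sum_apply, Pi.single_apply]

theorem heis_hom_ext {M : Type*} [AddCommGroup M] [Module ℂ M] {φ ψ : Heis n →ₗ[ℂ] M}
    (hx : ∀ i, φ (xH i) = ψ (xH i)) (hy : ∀ i, φ (yH i) = ψ (yH i))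
    (hz : φ (zH n) = ψ (zH n)) : φ = ψ := by
  ext1 a
  rw [heis_decomposition a]
  simp only [map_add, map_sum, map_smul, hx, hy, hz]

theorem apply_swap_of_alternating {M : Type*} [AddCommGroup M] [Module ℂ M]
    {φ : Heis n →ₗ[ℂ] Heis n →ₗ[ℂ] M} (hφ : ∀ a, φ a a = 0) (a b : Heis n) :
    φ b a = -φ a b := by
  have h := hφ (a + b)
  simp only [map_add, LinearMap.add_apply, hφ, zero_add, add_zero] at h
  exact eq_neg_of_add_eq_zero_right (by rwa [add_comm] at h)

end Bracket

/-- The `2 × 2` minor `a_i b_j - a_j b_i`. -/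
def minor {n : ℕ} (a b : Heis n) (i j : HIdx n) : ℂ := a i * b j - a j * b i

/-- The value at `(a, b)` of the invariant cocycle with parameters `p = (α, β, γ, μ)`. -/
def invCocycleFun (p : Fin 4 → ℂ) (a b : Heis 2) : Sch 2 := fun j =>
  match j with
  | .H => p 2 * (minor a b (.X 0) (.Y 1) - minor a b (.X 1) (.Y 0))
  | .E => -2 * p 2 * minor a b (.X 0) (.X 1)
  | .F => 2 * p 2 * minor a b (.Y 0) (.Y 1)
  | .X i => 3 * p 2 * ![minor a b (.X 1) .Z, -minor a b (.X 0) .Z] i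
  | .Y i => 3 * p 2 * ![minor a b (.Y 1) .Z, -minor a b (.Y 0) .Z] i
  | .Z => p 0 * minor a b (.X 0) (.Y 0) + p 1 * minor a b (.X 1) (.Y 1) +
      p 3 * (minor a b (.X 0) (.Y 1) + minor a b (.X 1) (.Y 0))

theorem sch_two_ext {u v : Sch 2} (hH : u .H = v .H) (hE : u .E = v .E) (hF : u .F = v .F)
    (hX0 : u (.X 0) = v (.X 0)) (hX1 : u (.X 1) = v (.X 1))
    (hY0 : u (.Y 0) = v (.Y 0)) (hY1 : u (.Y 1) = v (.Y 1)) (hZ : u .Z = v .Z) : u = v := by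
  funext j
  match j with
  | .H => exact hH
  | .E => exact hE
  | .F => exact hF
  | .X 0 => exact hX0
  | .X 1 => exact hX1
  | .Y 0 => exact hY0
  | .Y 1 => exact hY1
  | .Z => exact hZ

/-- The family of invariant cocycles, as a linear map in the parameters `(α, β, γ, μ)`. -/
def invCocycle : (Fin 4 → ℂ) →ₗ[ℂ] Heis 2 →ₗ[ℂ] Heis 2 →ₗ[ℂ] Sch 2 where
  toFun p := LinearMap.mk₂ ℂ (invCocycleFun p)
    (by intros; apply sch_two_ext <;> simp [invCocycleFun, minor] <;> ring)
    (by intros; apply sch_two_ext <;> simp [invCocycleFun, minor] <;> ring)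
    (by intros; apply sch_two_ext <;> simp [invCocycleFun, minor] <;> ring)
    (by intros; apply sch_two_ext <;> simp [invCocycleFun, minor] <;> ring)
  map_add' p q := by
    refine LinearMap.ext₂ fun a b => ?_
    apply sch_two_ext <;> simp [invCocycleFun] <;> ring
  map_smul' c p := by
    refine LinearMap.ext₂ fun a b => ?_
    apply sch_two_ext <;> simp [invCocycleFun] <;> ring

theorem invCocycle_apply (p : Fin 4 → ℂ) (a b : Heis 2) :
    invCocycle p a b = invCocycleFun p a b := rfl

theorem invCocycle_self (p : Fin 4 → ℂ) (a : Heis 2) : invCocycle p a a = 0 := by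
  rw [invCocycle_apply]
  have h (i j : HIdx 2) : minor a a i j = 0 := sub_eq_zero.2 (mul_comm _ _)
  apply sch_two_ext <;> simp [invCocycleFun, h]

theorem invCocycle_mem (p : Fin 4 → ℂ) : invCocycle p ∈ adjInvZ2Heis 2 := by
  refine ⟨invCocycle_self p, fun a b c => ?_, fun v hv a b => ?_⟩
  · simp only [invCocycle_apply]
    apply sch_two_ext <;>
      simp [invCocycleFun, minor, brH, act, brL, br, ιH, Fin.sum_univ_two] <;> ring
  · obtain ⟨hX, hY, hZ⟩ := apply_eq_zero_of_mem_sl2 hv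
    simp only [invCocycle_apply]
    apply sch_two_ext <;>
      simp [invCocycleFun, minor, act, brL, br, ιH, hX, hY] <;> ring

/-- The values of an invariant cocycle with parameters `(α, β, γ, μ)` on basis vectors. -/
def HasInvCocycleValues (φ : Heis 2 →ₗ[ℂ] Heis 2 →ₗ[ℂ] Sch 2) (α β γ μ : ℂ) : Prop :=
  φ (xH 0) (xH 1) = (-2 * γ) • eV 2 ∧
  φ (xH 0) (yH 0) = α • zV 2 ∧
  φ (xH 0) (yH 1) = γ • hV 2 + μ • zV 2 ∧
  φ (yH 0) (yH 1) = (2 * γ) • fV 2 ∧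
  φ (xH 1) (yH 1) = β • zV 2 ∧
  φ (xH 1) (yH 0) = (-γ) • hV 2 + μ • zV 2 ∧
  φ (xH 0) (zH 2) = (-3 * γ) • xV 1 ∧
  φ (yH 0) (zH 2) = (-3 * γ) • yV 1 ∧
  φ (xH 1) (zH 2) = (3 * γ) • xV 0 ∧
  φ (yH 1) (zH 2) = (3 * γ) • yV 0

theorem hasInvCocycleValues_invCocycle (p : Fin 4 → ℂ) :
    HasInvCocycleValues (invCocycle p) (p 0) (p 1) (p 2) (p 3) := by
  refine ⟨?_, ?_, ?_, ?_, ?_, ?_, ?_, ?_, ?_, ?_⟩ <;> rw [invCocycle_apply] <;>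
    apply sch_two_ext <;>
    simp [invCocycleFun, minor, xH, yH, zH, xV, yV, zV, hV, eV, fV]

theorem eq_invCocycle {φ : Heis 2 →ₗ[ℂ] Heis 2 →ₗ[ℂ] Sch 2} (hφ : ∀ a, φ a a = 0)
    {α β γ μ : ℂ} (h : HasInvCocycleValues φ α β γ μ) : φ = invCocycle ![α, β, γ, μ] := by
  have h' := hasInvCocycleValues_invCocycle ![α, β, γ, μ]
  obtain ⟨h1, h2, h3, h4, h5, h6, h7, h8, h9, h10⟩ := h
  obtain ⟨k1, k2, k3, k4, k5, k6, k7, k8, k9, k10⟩ := h'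
  have hs := apply_swap_of_alternating hφ
  have ks := apply_swap_of_alternating (invCocycle_self ![α, β, γ, μ])
  have hself (a : Heis 2) : φ a a = invCocycle ![α, β, γ, μ] a a := by
    rw [hφ, invCocycle_self]
  have e1 := h1.trans k1.symm
  have e2 := h2.trans k2.symm
  have e3 := h3.trans k3.symm
  have e4 := h4.trans k4.symm
  have e5 := h5.trans k5.symm
  have e6 := h6.trans k6.symm
  have e7 := h7.trans k7.symm
  have e8 := h8.trans k8.symm
  have e9 := h9.trans k9.symm
  have e10 := h10.trans k10.symm
  have swap {a b : Heis 2} (e : φ a b = invCocycle ![α, β, γ, μ] a b) :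
      φ b a = invCocycle ![α, β, γ, μ] b a := by rw [hs, ks, e]
  refine heis_hom_ext (Fin.forall_fin_two.2 ⟨?_, ?_⟩) (Fin.forall_fin_two.2 ⟨?_, ?_⟩) ?_ <;>
    refine heis_hom_ext (Fin.forall_fin_two.2 ⟨?_, ?_⟩) (Fin.forall_fin_two.2 ⟨?_, ?_⟩) ?_ <;>
    first
    | exact hself _
    | assumption
    | exact swap (by assumption)

section Invariance

variable {φ : Heis 2 →ₗ[ℂ] Heis 2 →ₗ[ℂ] Sch 2}

theorem apply_eq_zero_of_weight {w : Sch 2} {k : ℂ} (h : brL 2 (hV 2) w = k • w) :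
    k * w .H = 0 ∧ (2 - k) * w .E = 0 ∧ (2 + k) * w .F = 0 ∧
      (∀ i, (1 - k) * w (.X i) = 0) ∧ (∀ i, (1 + k) * w (.Y i) = 0) ∧ k * w .Z = 0 := by
  have hH := congrFun h .H
  have hE := congrFun h .E
  have hF := congrFun h .F
  have hX (i) := congrFun h (.X i)
  have hY (i) := congrFun h (.Y i)
  have hZ := congrFun h .Z
  simp [-mul_eq_mul_right_iff, -zero_eq_mul, -Fin.forall_fin_two, brL, br, hV] at hH hE hF hX hY hZ
  refine ⟨hH.symm, ?_, ?_, fun i => ?_, fun i => ?_, hZ.symm⟩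
  · linear_combination hE
  · linear_combination -hF
  · linear_combination hX i
  · linear_combination -hY i

theorem exists_eq_smul_eV {w : Sch 2} (h : brL 2 (hV 2) w = (2 : ℂ) • w) :
    ∃ c : ℂ, w = c • eV 2 := by
  obtain ⟨h1, h2, h3, h4, h5, h6⟩ := apply_eq_zero_of_weight h
  norm_num at h1 h2 h3 h4 h5 h6
  refine ⟨w .E, ?_⟩
  apply sch_two_ext <;> simp [eV, *]

theorem exists_eq_smul_fV {w : Sch 2} (h : brL 2 (hV 2) w = (-2 : ℂ) • w) :
    ∃ c : ℂ, w = c • fV 2 := by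
  obtain ⟨h1, h2, h3, h4, h5, h6⟩ := apply_eq_zero_of_weight h
  norm_num at h1 h2 h3 h4 h5 h6
  refine ⟨w .F, ?_⟩
  apply sch_two_ext <;> simp [fV, *]

theorem exists_eq_smul_hV_add_smul_zV {w : Sch 2} (h : brL 2 (hV 2) w = (0 : ℂ) • w) :
    ∃ c d : ℂ, w = c • hV 2 + d • zV 2 := by
  obtain ⟨h1, h2, h3, h4, h5, h6⟩ := apply_eq_zero_of_weight h
  norm_num at h1 h2 h3 h4 h5 h6
  refine ⟨w .H, w .Z, ?_⟩
  apply sch_two_ext <;> simp [hV, zV, *]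

theorem exists_hasInvCocycleValues (hφ : φ ∈ adjInvZ2Heis 2) :
    ∃ α β γ μ, HasInvCocycleValues φ α β γ μ := by
  obtain ⟨halt, hcoc, hinv⟩ := hφ
  have hs := apply_swap_of_alternating halt
  have hh (a b) := hinv (hV 2) (Submodule.subset_span (by simp)) a b
  have he (a b) := hinv (eV 2) (Submodule.subset_span (by simp)) a b
  have hf (a b) := hinv (fV 2) (Submodule.subset_span (by simp)) a b
  obtain ⟨B, hB⟩ := exists_eq_smul_fV (w := φ (yH 0) (yH 1)) (by
    have := hh (yH 0) (yH 1)
    simp only [act_hV_yH, map_neg, LinearMap.neg_apply] at this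
    linear_combination (norm := module) this)
  have hxy (i j : Fin 2) := exists_eq_smul_hV_add_smul_zV (w := φ (xH i) (yH j)) (by
    have := hh (xH i) (yH j)
    simp only [act_hV_xH, act_hV_yH, map_neg] at this
    linear_combination (norm := module) this)
  choose c d hcd using hxy
  have hxx (i j : Fin 2) : φ (xH i) (xH j) = (-2 * c i j) • eV 2 := by
    have := he (xH i) (yH j)
    simp only [act_eV_xH, act_eV_yH, map_zero, LinearMap.zero_apply, hcd, map_add, map_smul,
      brL_eV_hV, brL_zV] at this
    linear_combination (norm := module) -this
  have hc0 (i : Fin 2) : c i i = 0 := by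
    simpa [halt, eV] using congrFun (hxx i i) .E
  have hc : c 1 0 = -c 0 1 := by
    have := congrFun (hs (xH 0) (xH 1)) .E
    simp [hxx, eV] at this
    linear_combination -this / 2
  have hyy := he (yH 0) (yH 1)
  rw [act_eV_yH, act_eV_yH, hs (xH 1) (yH 0), hcd, hcd, hB, map_smul, brL_eV_fV] at hyy
  have hB' : B = 2 * c 0 1 := by
    have := congrFun hyy .H
    simp [hV, zV] at this
    linear_combination this - hc
  have hd : d 1 0 = d 0 1 := by
    have := congrFun hyy .Z
    simp [hV, zV] at this
    linear_combination this
  have hxz0 : φ (xH 0) (zH 2) = (-3 * c 0 1) • xV 1 := by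
    have := hcoc (xH 1) (yH 1) (xH 0)
    rw [hs (xH 0) (yH 1), hcd, hcd, hxx] at this
    simp [brH_xH_xH, brH_xH_yH, brH_yH_xH, brL_xH_hV, brL_yH_eV, brL_zV, hc0] at this
    linear_combination (norm := module) this
  have hxz1 : φ (xH 1) (zH 2) = (3 * c 0 1) • xV 0 := by
    have := hcoc (xH 0) (yH 0) (xH 1)
    rw [hs (xH 1) (yH 0), hcd, hcd, hxx] at this
    simp [brH_xH_xH, brH_xH_yH, brH_yH_xH, brL_xH_hV, brL_yH_eV, brL_zV, hc0, hc] at this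
    linear_combination (norm := module) this
  have hyz (i : Fin 2) : φ (yH i) (zH 2) = brL 2 (fV 2) (φ (xH i) (zH 2)) := by
    have := hf (xH i) (zH 2)
    rw [act_fV_xH, act_fV_zH, map_zero] at this
    linear_combination (norm := module) -this
  refine ⟨d 0 0, d 1 1, c 0 1, d 0 1, hxx 0 1, ?_, hcd 0 1, ?_, ?_, ?_, hxz0, ?_, hxz1, ?_⟩
  · simp [hcd, hc0]
  · rw [hB, hB']
  · simp [hcd, hc0]
  · rw [hcd, hc, hd]
  · rw [hyz, hxz0, map_smul, brL_fV_xV]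
  · rw [hyz, hxz1, map_smul, brL_fV_xV]

end Invariance

theorem mem_adjInvZ2Heis_iff_mem_range (φ : Heis 2 →ₗ[ℂ] Heis 2 →ₗ[ℂ] Sch 2) :
    φ ∈ adjInvZ2Heis 2 ↔ φ ∈ LinearMap.range invCocycle := by
  constructor
  · intro hφ
    obtain ⟨α, β, γ, μ, h⟩ := exists_hasInvCocycleValues hφ
    exact ⟨_, (eq_invCocycle hφ.1 h).symm⟩
  · rintro ⟨p, rfl⟩
    exact invCocycle_mem p

theorem invCocycle_injective : Function.Injective invCocycle := by
  rw [← LinearMap.ker_eq_bot, LinearMap.ker_eq_bot']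
  intro p hp
  obtain ⟨-, h2, h3, -, h5, -⟩ := hasInvCocycleValues_invCocycle p
  simp only [hp, LinearMap.zero_apply] at h2 h3 h5
  have e0 := congrFun h2 .Z
  have e1 := congrFun h5 .Z
  have e2 := congrFun h3 .H
  have e3 := congrFun h3 .Z
  simp [hV, zV] at e0 e1 e2 e3
  funext i
  fin_cases i <;> simp [← e0, ← e1, ← e2, ← e3]

/-- **The space of `sl_2`-invariant 2-cocycles of the Heisenberg ideal `h_2` with values
in the adjoint module `sch_2` has dimension `4`; concretely, it consists exactly of the
alternating bilinear maps `φ` determined by parameters `α, β, γ, μ` via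
`φ(x_1,x_2) = -2γe`, `φ(x_1,y_1) = αz`, `φ(x_1,y_2) = γh + μz`, `φ(y_1,y_2) = 2γf`,
`φ(x_2,y_2) = βz`, `φ(x_2,y_1) = -γh + μz`, `φ(x_1,z) = -3γx_2`, `φ(y_1,z) = -3γy_2`,
`φ(x_2,z) = 3γx_1`, `φ(y_2,z) = 3γy_1`.** -/
theorem adjInvZ2Heis_two_description :
    Module.finrank ℂ ↥(adjInvZ2Heis 2) = 4 ∧
      ∀ φ : Heis 2 →ₗ[ℂ] Heis 2 →ₗ[ℂ] Sch 2, (∀ a, φ a a = 0) →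
        (φ ∈ adjInvZ2Heis 2 ↔
          ∃ α β γ μ : ℂ,
            φ (xH 0) (xH 1) = (-2 * γ) • eV 2 ∧
            φ (xH 0) (yH 0) = α • zV 2 ∧
            φ (xH 0) (yH 1) = γ • hV 2 + μ • zV 2 ∧
            φ (yH 0) (yH 1) = (2 * γ) • fV 2 ∧
            φ (xH 1) (yH 1) = β • zV 2 ∧
            φ (xH 1) (yH 0) = (-γ) • hV 2 + μ • zV 2 ∧
            φ (xH 0) (zH 2) = (-3 * γ) • xV 1 ∧
            φ (yH 0) (zH 2) = (-3 * γ) • yV 1 ∧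
            φ (xH 1) (zH 2) = (3 * γ) • xV 0 ∧
            φ (yH 1) (zH 2) = (3 * γ) • yV 0) := by
  refine ⟨?_, fun φ hφ => ⟨exists_hasInvCocycleValues, ?_⟩⟩
  · have h : adjInvZ2Heis 2 = LinearMap.range invCocycle :=
      SetLike.ext mem_adjInvZ2Heis_iff_mem_range
    rw [h, LinearMap.finrank_range_of_inj invCocycle_injective, Module.finrank_fin_fun]
  · rintro ⟨α, β, γ, μ, h⟩
    rw [eq_invCocycle hφ h]
    exact invCocycle_mem _
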